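/- Every Hilbert geometry (X,d) has bounded coarse geometry: there exists ε > 0 such that for every R > 0, the supremum over all x ∈ X of the maximal cardinality of an ε-separated set inside the closed ball B(x,R) is finite. In fact, any 2ε-separated subset of a closed R-ball has at most ((e^{2(R+ε)}−1)/(e^ε−1))ⁿ elements. -/

import Mathlib

open Real

/-- `d` is the Hilbert metric of the bounded convex domain `X ⊆ ℝⁿ`:
`d x x = 0` on `X`, and for distinct `x, y ∈ X`, whenever `x', y'` are the
boundary points of the chord through `x` and `y` with `x', x, y, y'` in this
order, `d x y` is the logarithm of the cross ratio. -/
def IsHilbertMetric {n : ℕ} (X : Set (EuclideanSpace ℝ (Fin n)))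
    (d : EuclideanSpace ℝ (Fin n) → EuclideanSpace ℝ (Fin n) → ℝ) : Prop :=
  (∀ x ∈ X, d x x = 0) ∧
  ∀ x ∈ X, ∀ y ∈ X, x ≠ y → ∀ x' ∈ frontier X, ∀ y' ∈ frontier X,
    x ∈ segment ℝ x' y → y ∈ segment ℝ x y' →
    d x y = Real.log ((dist x y' * dist y x') / (dist x x' * dist y y'))

open MeasureTheory Module Pointwise in
/-- Packing bound: `l` disjoint translates of `c • K` inside a translate of `D • K` satisfy
`l ≤ (D / c) ^ dim`. -/
lemma card_le_of_disjoint_translates {E : Type*} [NormedAddCommGroup E] [NormedSpace ℝ E]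
    [FiniteDimensional ℝ E] [MeasurableSpace E] [BorelSpace E] {K : Set E} (hK : IsOpen K)
    (hKne : K.Nonempty) (hKb : Bornology.IsBounded K) {c D : ℝ} (hc : 0 < c) (hD : 0 ≤ D)
    (x : E) (s : Finset E)
    (hdisj : (s : Set E).PairwiseDisjoint fun a ↦ a +ᵥ c • K)
    (hsub : ∀ a ∈ s, a +ᵥ c • K ⊆ x +ᵥ D • K) :
    (s.card : ℝ) ≤ (D / c) ^ finrank ℝ E := by
  let μ : Measure E := Measure.addHaar
  have hpos : 0 < μ.real K :=
    ENNReal.toReal_pos (hK.measure_pos μ hKne).ne' hKb.measure_lt_top.ne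
  have hvol : ∀ (a : E) (r : ℝ), 0 ≤ r → μ.real (a +ᵥ r • K) = r ^ finrank ℝ E * μ.real K := by
    intro a r hr
    rw [measureReal_def, measure_vadd, Measure.addHaar_smul, ENNReal.toReal_mul,
      abs_of_nonneg (by positivity), ENNReal.toReal_ofReal (by positivity), measureReal_def]
  have hsum : ∑ a ∈ s, μ.real (a +ᵥ c • K) ≤ μ.real (x +ᵥ D • K) := by
    rw [← measureReal_biUnion_finset hdisj
      (fun a _ ↦ ((hK.smul₀ hc.ne').vadd a).measurableSet)
      (fun a _ ↦ ((hKb.smul₀ c).vadd a).measure_lt_top.ne)]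
    exact measureReal_mono (Set.iUnion₂_subset hsub) ((hKb.smul₀ D).vadd x).measure_lt_top.ne
  rw [Finset.sum_congr rfl fun a _ ↦ hvol a c hc.le, Finset.sum_const, nsmul_eq_mul,
    hvol x D hD, ← mul_assoc] at hsum
  rw [div_pow, le_div_iff₀ (by positivity)]
  exact le_of_mul_le_mul_right hsum hpos

lemma translate_mem_nhds {E : Type*} [NormedAddCommGroup E] {X : Set E} (hX : IsOpen X)
    {x : E} (hx : x ∈ X) :
    (fun z ↦ x + z) ⁻¹' X ∈ nhds (0 : E) :=
  (hX.preimage (continuous_const_add x)).mem_nhds (by simpa using hx)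

section HilbertGeometry

variable {E : Type*} [NormedAddCommGroup E] [NormedSpace ℝ E]

/-- The gauge of the translate of `X` which moves `x` to the origin. -/
noncomputable def pointedGauge (X : Set E) (x v : E) : ℝ := gauge ((fun z ↦ x + z) ⁻¹' X) v

/-- `FunkLE X x y m` says that the Funk distance from `x` to `y` in `X` is at most `-log m`. -/
def FunkLE (X : Set E) (x y : E) (m : ℝ) : Prop :=
  0 < m ∧ m ≤ 1 ∧ ∃ p ∈ closure X, y = m • x + (1 - m) • p

/-- `HilbertLE X x y r` says that the sum of the two Funk distances between `x` and `y`,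
that is, their Hilbert distance, is at most `r`. -/
def HilbertLE (X : Set E) (x y : E) (r : ℝ) : Prop :=
  ∃ m k, FunkLE X x y m ∧ FunkLE X y x k ∧ Real.exp (-r) ≤ m * k

variable {X : Set E}

lemma FunkLE.trans (hX : Convex ℝ X) {x y z : E} {m k : ℝ} (hxy : FunkLE X x y m)
    (hyz : FunkLE X y z k) : FunkLE X x z (m * k) := by
  obtain ⟨hm, hm1, p, hp, rfl⟩ := hxy
  obtain ⟨hk, hk1, q, hq, rfl⟩ := hyz
  refine ⟨by positivity, mul_le_one₀ hm1 hk.le hk1, ?_⟩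
  rcases hm1.eq_or_lt with rfl | hm1
  · exact ⟨q, hq, by module⟩
  have hmk : 0 < 1 - m * k := by nlinarith
  refine ⟨((1 - m) * k / (1 - m * k)) • p + ((1 - k) / (1 - m * k)) • q,
    hX.closure hp hq (div_nonneg (mul_nonneg (by linarith) hk.le) hmk.le)
      (div_nonneg (by linarith) hmk.le) (by field_simp; ring), ?_⟩
  have hmk' : 1 - k * m ≠ 0 := by linarith
  match_scalars <;> field_simp

lemma HilbertLE.symm {x y : E} {r : ℝ} (h : HilbertLE X x y r) : HilbertLE X y x r := by
  obtain ⟨m, k, hm, hk, h⟩ := h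
  exact ⟨k, m, hk, hm, by rwa [mul_comm]⟩

lemma HilbertLE.trans (hX : Convex ℝ X) {x y z : E} {r t : ℝ} (hxy : HilbertLE X x y r)
    (hyz : HilbertLE X y z t) : HilbertLE X x z (r + t) := by
  obtain ⟨m, k, hm, hk, h⟩ := hxy
  obtain ⟨m', k', hm', hk', h'⟩ := hyz
  refine ⟨m * m', k' * k, hm.trans hX hm', hk'.trans hX hk, ?_⟩
  calc Real.exp (-(r + t)) = Real.exp (-r) * Real.exp (-t) := by rw [← Real.exp_add]; ring_nf
    _ ≤ (m * k) * (m' * k') :=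
      mul_le_mul h h' (Real.exp_pos _).le (mul_nonneg hm.1.le hk.1.le)
    _ = m * m' * (k' * k) := by ring

lemma convex_translate (hX : Convex ℝ X) (x : E) : Convex ℝ ((fun z ↦ x + z) ⁻¹' X) :=
  hX.translate_preimage_right x

lemma pointedGauge_nonneg (x v : E) : 0 ≤ pointedGauge X x v := gauge_nonneg _

lemma pointedGauge_smul (x v : E) {t : ℝ} (ht : 0 ≤ t) :
    pointedGauge X x (t • v) = t * pointedGauge X x v :=
  gauge_smul_of_nonneg ht v

lemma continuous_pointedGauge (hconv : Convex ℝ X) (hopen : IsOpen X) {x : E} (hx : x ∈ X) :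
    Continuous (pointedGauge X x) :=
  continuous_gauge (convex_translate hconv x) (translate_mem_nhds hopen hx)

lemma pointedGauge_sub_lt_one (hopen : IsOpen X) {x y : E} (hy : y ∈ X) :
    pointedGauge X x (y - x) < 1 :=
  gauge_lt_one_of_mem_of_isOpen (hopen.preimage (continuous_const_add x)) (by simpa using hy)

open Pointwise in
lemma pointedGauge_pos (hopen : IsOpen X) (hbdd : Bornology.IsBounded X) {x v : E} (hx : x ∈ X)
    (hv : v ≠ 0) : 0 < pointedGauge X x v := by
  refine (gauge_pos (absorbent_nhds_zero (translate_mem_nhds hopen hx)) ?_).2 hv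
  rw [NormedSpace.isVonNBounded_iff]
  refine (hbdd.vadd (-x)).subset fun z hz ↦ ?_
  rwa [Set.mem_vadd_set_iff_neg_vadd_mem, neg_neg]

lemma add_mem_of_pointedGauge_lt_one (hconv : Convex ℝ X) (hopen : IsOpen X) {x v : E}
    (hx : x ∈ X) (hv : pointedGauge X x v < 1) : x + v ∈ X := by
  have h := translate_mem_nhds hopen hx
  exact setOfPred_gauge_lt_one_subset_self (convex_translate hconv x) (mem_of_mem_nhds h)
    (absorbent_nhds_zero h) hv

lemma pointedGauge_sub_le_one (hconv : Convex ℝ X) (hopen : IsOpen X) {x p : E} (hx : x ∈ X)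
    (hp : p ∈ closure X) : pointedGauge X x (p - x) ≤ 1 := by
  refine (gauge_le_one_iff_mem_closure (convex_translate hconv x)
    (translate_mem_nhds hopen hx)).2 ?_
  have := (Homeomorph.addLeft x).preimage_closure X
  simp only [Homeomorph.coe_addLeft] at this
  rw [← this]
  simpa using hp

lemma add_smul_mem_frontier (hconv : Convex ℝ X) (hopen : IsOpen X) {x v : E} (hx : x ∈ X)
    (hv : 0 < pointedGauge X x v) : x + (pointedGauge X x v)⁻¹ • v ∈ frontier X := by
  have h := (gauge_eq_one_iff_mem_frontier (x := (pointedGauge X x v)⁻¹ • v)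
    (convex_translate hconv x) (translate_mem_nhds hopen hx)).1
    ((pointedGauge_smul x v (inv_nonneg.2 hv.le)).trans (inv_mul_cancel₀ hv.ne'))
  have hf := (Homeomorph.addLeft x).preimage_frontier X
  simp only [Homeomorph.coe_addLeft] at hf
  rwa [← hf] at h

lemma FunkLE.pointedGauge_le (hconv : Convex ℝ X) (hopen : IsOpen X) {x y : E} {m : ℝ}
    (hx : x ∈ X) (h : FunkLE X x y m) : pointedGauge X x (y - x) ≤ 1 - m := by
  obtain ⟨_, hm1, p, hp, rfl⟩ := h
  rw [show m • x + (1 - m) • p - x = (1 - m) • (p - x) by module,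
    pointedGauge_smul _ _ (by linarith)]
  exact mul_le_of_le_one_right (by linarith) (pointedGauge_sub_le_one hconv hopen hx hp)

lemma FunkLE.pointedGauge_le_reverse (hconv : Convex ℝ X) (hopen : IsOpen X) {x y : E} {k : ℝ}
    (hx : x ∈ X) (h : FunkLE X y x k) : pointedGauge X x (x - y) ≤ k⁻¹ - 1 := by
  obtain ⟨hk, hk1, p, hp, h⟩ := h
  have hk' : 0 ≤ k⁻¹ - 1 := by linarith [(one_le_inv₀ hk).2 hk1]
  have hxy : x - y = (k⁻¹ - 1) • (p - x) := by
    rw [h]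
    match_scalars <;> field_simp <;> ring
  rw [hxy, pointedGauge_smul _ _ hk']
  exact mul_le_of_le_one_right hk' (pointedGauge_sub_le_one hconv hopen hx hp)

/-- A Hilbert ball is contained in a ball of the Finsler norm at its center. -/
lemma HilbertLE.pointedGauge_add_le (hconv : Convex ℝ X) (hopen : IsOpen X) {x y : E} {r : ℝ}
    (hr : 0 ≤ r) (hx : x ∈ X) (h : HilbertLE X x y r) :
    pointedGauge X x (y - x) + pointedGauge X x (-(y - x)) ≤ Real.exp r - 1 := by
  obtain ⟨m, k, hm, hk, h⟩ := h
  have h1 := hm.pointedGauge_le hconv hopen hx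
  have h2 := hk.pointedGauge_le_reverse hconv hopen hx
  rw [neg_sub]
  have h3 : k⁻¹ ≤ m * Real.exp r := by
    rw [Real.exp_neg, inv_le_iff_one_le_mul₀ (Real.exp_pos r)] at h
    rw [inv_le_iff_one_le_mul₀ hk.1]
    linarith
  nlinarith [hm.2.1, Real.one_le_exp hr]

open Pointwise in
/-- A ball of the Finsler norm at `x` of a suitable radius, recentered at a point `y` of the
Hilbert ball of radius `R` around `x`, is contained in the Hilbert `ε`-ball around `y`. -/
lemma HilbertLE.add_of_pointedGauge_lt (hconv : Convex ℝ X) (hopen : IsOpen X) {x y w : E}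
    {R ε : ℝ} (hx : x ∈ X) (h : HilbertLE X x y R)
    (hw : pointedGauge X x w + pointedGauge X x (-w) <
      Real.exp (-R) * (1 - Real.exp (-ε))) : HilbertLE X y (y + w) ε := by
  obtain ⟨m, k, ⟨hm, hm1, p, hp, rfl⟩, ⟨hk, hk1, -⟩, hR⟩ := h
  have hRm : Real.exp (-R) ≤ m := hR.trans (mul_le_of_le_one_right hm.le hk1)
  set e := Real.exp (-ε) with he
  have hepos : 0 < e := Real.exp_pos _
  have hw' : pointedGauge X x w + pointedGauge X x (-w) < m * (1 - e) := by
    refine hw.trans_le (mul_le_mul_of_nonneg_right hRm ?_)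
    by_contra! hneg
    nlinarith [pointedGauge_nonneg (X := X) x w, pointedGauge_nonneg (X := X) x (-w),
      Real.exp_pos (-R)]
  set δ := (m * (1 - e) - (pointedGauge X x w + pointedGauge X x (-w))) / 2 with hδ
  have hδ0 : 0 < δ := by rw [hδ]; linarith
  have habs : Absorbent ℝ _ := absorbent_nhds_zero (translate_mem_nhds hopen hx)
  obtain ⟨α, hα, hα', u, hu, huw⟩ := exists_lt_of_gauge_lt habs
    (show gauge ((fun z ↦ x + z) ⁻¹' X) w < pointedGauge X x w + δ from lt_add_of_pos_right _ hδ0)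
  obtain ⟨β, hβ, hβ', v, hv, hvw⟩ := exists_lt_of_gauge_lt habs
    (show gauge ((fun z ↦ x + z) ⁻¹' X) (-w) < pointedGauge X x (-w) + δ from
      lt_add_of_pos_right _ hδ0)
  simp only at huw hvw
  have hsum : α + β < m * (1 - e) := by rw [hδ] at hα' hβ'; linarith
  have hαm : α < m := by nlinarith
  have hmem : ∀ z ∈ (fun z ↦ x + z) ⁻¹' X, m • (x + z) + (1 - m) • p ∈ closure X := fun z hz ↦
    hconv.closure (subset_closure hz) hp hm.le (by linarith) (by ring)
  refine ⟨1 - α / m, m / (m + β), ⟨?_, ?_, _, hmem u hu, ?_⟩, ⟨by positivity, ?_, _, hmem v hv, ?_⟩,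
    ?_⟩
  · rw [sub_pos, div_lt_one hm]; exact hαm
  · have : 0 < α / m := by positivity
    linarith
  · rw [← huw]
    match_scalars <;> field_simp <;> ring
  · rw [div_le_one (by positivity)]; linarith
  · rw [show w = -(β • v) by rw [hvw, neg_neg]]
    match_scalars <;> field_simp <;> ring
  · rw [show (1 - α / m) * (m / (m + β)) = (m - α) / (m + β) by field_simp,
      le_div_iff₀ (by positivity)]
    nlinarith

end HilbertGeometry

section HilbertMetric

variable {n : ℕ} {X : Set (EuclideanSpace ℝ (Fin n))}
  {d : EuclideanSpace ℝ (Fin n) → EuclideanSpace ℝ (Fin n) → ℝ}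

/-- The Hilbert distance in terms of the gauges at the first point. -/
lemma IsHilbertMetric.eq_log (hd : IsHilbertMetric X d) (hconv : Convex ℝ X) (hopen : IsOpen X)
    (hbdd : Bornology.IsBounded X) {x y : EuclideanSpace ℝ (Fin n)} (hx : x ∈ X) (hy : y ∈ X)
    (hxy : x ≠ y) :
    d x y = Real.log ((1 + pointedGauge X x (x - y)) / (1 - pointedGauge X x (y - x))) := by
  have hg := pointedGauge_pos hopen hbdd hx (sub_ne_zero.2 hxy.symm)
  have hg' := pointedGauge_pos hopen hbdd hx (sub_ne_zero.2 hxy)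
  have hg1 := pointedGauge_sub_lt_one (x := x) hopen hy
  have hy' := add_smul_mem_frontier hconv hopen hx hg
  have hx' := add_smul_mem_frontier hconv hopen hx hg'
  set g := pointedGauge X x (y - x)
  set g' := pointedGauge X x (x - y)
  have hN : 0 < ‖y - x‖ := norm_pos_iff.2 (sub_ne_zero.2 hxy.symm)
  have hinv : 1 < g⁻¹ := (one_lt_inv₀ hg).2 hg1
  have d1 : dist x (x + g⁻¹ • (y - x)) = g⁻¹ * ‖y - x‖ := by
    rw [dist_self_add_right, norm_smul, Real.norm_of_nonneg (by positivity)]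
  have d2 : dist y (x + g'⁻¹ • (x - y)) = (1 + g'⁻¹) * ‖y - x‖ := by
    rw [dist_eq_norm, show y - (x + g'⁻¹ • (x - y)) = (1 + g'⁻¹) • (y - x) by module,
      norm_smul, Real.norm_of_nonneg (by positivity)]
  have d3 : dist x (x + g'⁻¹ • (x - y)) = g'⁻¹ * ‖y - x‖ := by
    rw [dist_self_add_right, norm_smul, Real.norm_of_nonneg (by positivity), norm_sub_rev]
  have d4 : dist y (x + g⁻¹ • (y - x)) = (g⁻¹ - 1) * ‖y - x‖ := by
    rw [dist_comm, dist_eq_norm, show x + g⁻¹ • (y - x) - y = (g⁻¹ - 1) • (y - x) by module,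
      norm_smul, Real.norm_of_nonneg (by linarith)]
  rw [hd.2 x hx y hy hxy _ hx' _ hy', d1, d2, d3, d4]
  · congr 1
    have : g⁻¹ - 1 ≠ 0 := by linarith
    have : 1 - g ≠ 0 := by linarith
    rw [div_eq_div_iff (by positivity) this]
    field_simp
    ring
  · refine ⟨g' / (1 + g'), 1 / (1 + g'), by positivity, by positivity, by field_simp; ring, ?_⟩
    match_scalars <;> field_simp <;> ring
  · refine ⟨1 - g, g, by linarith, hg.le, by ring, ?_⟩
    match_scalars <;> field_simp <;> ring

lemma IsHilbertMetric.hilbertLE (hd : IsHilbertMetric X d) (hconv : Convex ℝ X)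
    (hopen : IsOpen X) (hbdd : Bornology.IsBounded X) {x y : EuclideanSpace ℝ (Fin n)} {r : ℝ}
    (hr : 0 ≤ r) (hx : x ∈ X) (hy : y ∈ X) (h : d x y ≤ r) : HilbertLE X x y r := by
  rcases eq_or_ne x y with rfl | hxy
  · have : FunkLE X x x 1 := ⟨one_pos, le_rfl, x, subset_closure hx, by module⟩
    exact ⟨1, 1, this, this, by simpa using hr⟩
  rw [hd.eq_log hconv hopen hbdd hx hy hxy] at h
  have hg := pointedGauge_pos hopen hbdd hx (sub_ne_zero.2 hxy.symm)
  have hg' := pointedGauge_pos hopen hbdd hx (sub_ne_zero.2 hxy)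
  have hg1 := pointedGauge_sub_lt_one (x := x) hopen hy
  have hy' := frontier_subset_closure (add_smul_mem_frontier hconv hopen hx hg)
  have hx' := frontier_subset_closure (add_smul_mem_frontier hconv hopen hx hg')
  set g := pointedGauge X x (y - x)
  set g' := pointedGauge X x (x - y)
  have h1g : 0 < 1 - g := by linarith
  refine ⟨1 - g, 1 / (1 + g'), ⟨h1g, by linarith, _, hy', ?_⟩,
    ⟨by positivity, by rw [div_le_one (by positivity)]; linarith, _, hx', ?_⟩, ?_⟩
  · match_scalars <;> field_simp <;> ring
  · match_scalars <;> field_simp <;> ring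
  · rw [Real.log_le_iff_le_exp (by positivity), div_le_iff₀ h1g] at h
    rw [mul_one_div, Real.exp_neg, le_div_iff₀ (by positivity), inv_mul_le_iff₀ (Real.exp_pos r)]
    exact h

lemma IsHilbertMetric.le_of_hilbertLE (hd : IsHilbertMetric X d) (hconv : Convex ℝ X)
    (hopen : IsOpen X) (hbdd : Bornology.IsBounded X) {x y : EuclideanSpace ℝ (Fin n)} {r : ℝ}
    (hx : x ∈ X) (hy : y ∈ X) (hxy : x ≠ y) (h : HilbertLE X x y r) : d x y ≤ r := by
  obtain ⟨m, k, hm, hk, h⟩ := h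
  have h1 := hm.pointedGauge_le hconv hopen hx
  have h2 := hk.pointedGauge_le_reverse hconv hopen hx
  have hg' := pointedGauge_nonneg (X := X) x (x - y)
  have hm0 := hm.1
  have hk0 := hk.1
  have h1g : 0 < 1 - pointedGauge X x (y - x) := by linarith
  rw [hd.eq_log hconv hopen hbdd hx hy hxy, Real.log_le_iff_le_exp (by positivity)]
  calc (1 + pointedGauge X x (x - y)) / (1 - pointedGauge X x (y - x)) ≤ k⁻¹ / m := by
        gcongr <;> linarith
    _ = (m * k)⁻¹ := by field_simp
    _ ≤ (Real.exp (-r))⁻¹ := inv_anti₀ (Real.exp_pos _) h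
    _ = Real.exp r := by rw [Real.exp_neg, inv_inv]

end HilbertMetric

open Pointwise in
theorem hilbert_bounded_coarse_geometry
    {n : ℕ} (hn : 2 ≤ n) (X : Set (EuclideanSpace ℝ (Fin n)))
    (hne : X.Nonempty) (hconv : Convex ℝ X) (hopen : IsOpen X)
    (hbdd : Bornology.IsBounded X)
    (d : EuclideanSpace ℝ (Fin n) → EuclideanSpace ℝ (Fin n) → ℝ)
    (hd : IsHilbertMetric X d) :
    ∀ ε > (0:ℝ), ∀ R > (0:ℝ), ∀ x ∈ X,
      ∀ s : Finset (EuclideanSpace ℝ (Fin n)),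
        (∀ a ∈ s, a ∈ X ∧ d x a ≤ R) →
        (∀ a ∈ s, ∀ b ∈ s, a ≠ b → 2 * ε < d a b) →
        (s.card : ℝ) ≤ ((Real.exp (2 * (R + ε)) - 1) / (Real.exp ε - 1)) ^ n := by
  intro ε hε R hR x hx s hs hsep
  set F : EuclideanSpace ℝ (Fin n) → ℝ := fun v ↦ pointedGauge X x v + pointedGauge X x (-v)
    with hF
  have hFsmul : ∀ (t : ℝ) v, 0 ≤ t → F (t • v) = t * F v := by
    intro t v ht
    simp only [hF, ← smul_neg, pointedGauge_smul x _ ht, mul_add]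
  have hg := continuous_pointedGauge hconv hopen hx
  have hFcont : Continuous F := hg.add (hg.comp continuous_neg)
  set K : Set (EuclideanSpace ℝ (Fin n)) := {v | F v < 1} with hK
  have hKsmul : ∀ (t : ℝ) v, 0 < t → (v ∈ t • K ↔ F v < t) := by
    intro t v ht
    rw [Set.mem_smul_set_iff_inv_smul_mem₀ ht.ne', hK, Set.mem_ofPred_eq,
      hFsmul _ _ (inv_nonneg.2 ht.le), inv_mul_lt_iff₀ ht, mul_one]
  have hKopen : IsOpen K := isOpen_lt hFcont continuous_const
  have hKne : K.Nonempty := ⟨0, by simp [hK, hF, pointedGauge]⟩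
  have hKbdd : Bornology.IsBounded K := by
    refine (hbdd.vadd (-x)).subset fun v hv ↦ ?_
    rw [Set.mem_vadd_set_iff_neg_vadd_mem, neg_neg, vadd_eq_add]
    exact add_mem_of_pointedGauge_lt_one hconv hopen hx
      ((le_add_of_nonneg_right (pointedGauge_nonneg x (-v))).trans_lt hv)
  have hεe : Real.exp (-ε) < 1 := Real.exp_lt_one_iff.2 (by linarith)
  have hc : 0 < Real.exp (-R) * (1 - Real.exp (-ε)) :=
    mul_pos (Real.exp_pos _) (by linarith)
  have hDe : Real.exp (-(R + ε)) < 1 := Real.exp_lt_one_iff.2 (by linarith)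
  have hDe' : 1 < Real.exp (R + ε) := Real.one_lt_exp_iff.2 (by linarith)
  have hD : 0 < Real.exp (R + ε) - Real.exp (-(R + ε)) := by linarith
  have hball : ∀ a ∈ s, HilbertLE X x a R := fun a ha ↦
    hd.hilbertLE hconv hopen hbdd hR.le hx (hs a ha).1 (hs a ha).2
  have hsmall : ∀ a ∈ s, ∀ z ∈ a +ᵥ (Real.exp (-R) * (1 - Real.exp (-ε))) • K,
      HilbertLE X a z ε := by
    rintro a ha _ ⟨w, hw, rfl⟩
    exact (hball a ha).add_of_pointedGauge_lt hconv hopen hx ((hKsmul _ _ hc).1 hw)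
  have key := card_le_of_disjoint_translates hKopen hKne hKbdd hc hD.le x s ?_ ?_
  · rw [finrank_euclideanSpace_fin] at key
    convert key using 2
    have h1 : Real.exp ε - 1 ≠ 0 := by linarith [Real.one_lt_exp_iff.2 hε]
    rw [div_eq_div_iff h1 hc.ne', two_mul, Real.exp_add (R + ε), Real.exp_neg (R + ε),
      Real.exp_neg, Real.exp_neg, Real.exp_add]
    field_simp
  · intro a ha b hb hab
    refine Set.disjoint_left.2 fun z hza hzb ↦ ?_
    have h := (hsmall a ha z hza).trans hconv (hsmall b hb z hzb).symm
    have := hd.le_of_hilbertLE hconv hopen hbdd (hs a ha).1 (hs b hb).1 hab h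
    linarith [hsep a ha b hb hab]
  · intro a ha z hz
    have h := ((hball a ha).trans hconv (hsmall a ha z hz)).pointedGauge_add_le hconv hopen
      (by linarith) hx
    rw [Set.mem_vadd_set_iff_neg_vadd_mem, vadd_eq_add, neg_add_eq_sub, hKsmul _ _ hD]
    simp only [hF]
    linarith
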